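/- The following are equivalent: (1) both ∫_{(0,t]} ∫_{ℝ^d} ∫_{(0,1]} p_s(y)·z · 1_{{p_s(y)z > 1}} λ(dz) dy ds < ∞ and ∫_{(0,t]} ∫_{ℝ^d} ∫_{(0,1]} (p_s(y)·z)² · 1_{{p_s(y)z ≤ 1}} λ(dz) dy ds < ∞; (2) ∫_{(0,1]} z^{min(1+α/d, 2)} |log z|^{κ} λ(dz) < ∞, where κ = 1 if d = α and κ = 0 otherwise. -/

import Mathlib

open MeasureTheory Set Filter Topology
open scoped ENNReal NNReal

/-- The heat-kernel profile `p_s(y) = s^{-d/α} g(|y|/s^{1/α})`. -/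
noncomputable def pker (d : ℕ) (α : ℝ) (g : ℝ → ℝ) (s : ℝ)
    (y : EuclideanSpace ℝ (Fin d)) : ℝ :=
  s ^ (-((d : ℝ) / α)) * g (‖y‖ / s ^ ((1 : ℝ) / α))

/-- Spatial scaling: integrating a function of `p_s` reduces to the profile at time one. -/
lemma lintegral_pker_comp {d : ℕ} {α : ℝ} {g : ℝ → ℝ}
    (hG : Measurable fun x : EuclideanSpace ℝ (Fin d) => g ‖x‖)
    {H : ℝ → ℝ≥0∞} (hH : Measurable H) {s : ℝ} (hs : 0 < s) :
    ∫⁻ y, H (pker d α g s y) =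
      ENNReal.ofReal (s ^ ((d : ℝ) / α)) *
        ∫⁻ x : EuclideanSpace ℝ (Fin d), H (s ^ (-((d : ℝ) / α)) * g ‖x‖) := by
  have hr : 0 < s ^ ((1 : ℝ) / α) := Real.rpow_pos_of_pos hs _
  have hmap := Measure.map_addHaar_smul (volume : Measure (EuclideanSpace ℝ (Fin d)))
    (inv_ne_zero hr.ne')
  have hf : Measurable fun x : EuclideanSpace ℝ (Fin d) => H (s ^ (-((d : ℝ) / α)) * g ‖x‖) :=
    hH.comp (hG.const_mul _)
  have key := lintegral_map (μ := volume) hf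
    (measurable_const_smul ((s ^ ((1 : ℝ) / α))⁻¹) :
      Measurable fun x : EuclideanSpace ℝ (Fin d) => (s ^ ((1 : ℝ) / α))⁻¹ • x)
  rw [hmap, lintegral_smul_measure] at key
  have hpow : |(((s ^ ((1 : ℝ) / α))⁻¹) ^ d)⁻¹| = s ^ ((d : ℝ) / α) := by
    rw [abs_of_nonneg (by positivity), inv_pow, inv_inv, ← Real.rpow_mul_natCast hs.le]
    congr 1
    rw [one_div, ← div_eq_inv_mul]
  rw [finrank_euclideanSpace_fin, hpow, smul_eq_mul] at key
  rw [key]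
  refine lintegral_congr fun y => ?_
  rw [pker, norm_smul, norm_inv, Real.norm_of_nonneg hr.le, div_eq_inv_mul ‖y‖]

/-- Scaling and Tonelli: the jump size becomes the outermost variable. -/
lemma lintegral_pker_jump_swap {d : ℕ} {α : ℝ} {g : ℝ → ℝ} (lam : Measure ℝ) [SFinite lam]
    (hG : Measurable fun x : EuclideanSpace ℝ (Fin d) => g ‖x‖)
    {H : ℝ → ℝ≥0∞} (hH : Measurable H) (t : ℝ) :
    ∫⁻ s in Ioc 0 t, ∫⁻ y, ∫⁻ z in Ioc (0 : ℝ) 1, H (pker d α g s y * z) ∂lam =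
      ∫⁻ z in Ioc (0 : ℝ) 1, ∫⁻ x : EuclideanSpace ℝ (Fin d), ∫⁻ s in Ioc 0 t,
        ENNReal.ofReal (s ^ ((d : ℝ) / α)) * H (s ^ (-((d : ℝ) / α)) * (g ‖x‖ * z)) ∂volume ∂volume ∂lam := by
  have hinner : Measurable fun u : ℝ => ∫⁻ z in Ioc (0 : ℝ) 1, H (u * z) ∂lam :=
    Measurable.lintegral_prod_right' (f := fun p : ℝ × ℝ => H (p.1 * p.2))
      (hH.comp (measurable_fst.mul measurable_snd))
  have hmeas : ∀ {β : Type} [MeasurableSpace β] {a b : β → ℝ}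
      {c : β → EuclideanSpace ℝ (Fin d)}, Measurable a → Measurable b → Measurable c →
      Measurable fun p => ENNReal.ofReal (a p ^ ((d : ℝ) / α)) *
        H (a p ^ (-((d : ℝ) / α)) * (g ‖c p‖ * b p)) := by
    intro β _ a b c ha hb hc
    exact (ha.pow_const _).ennreal_ofReal.mul
      (hH.comp ((ha.pow_const _).mul ((hG.comp hc).mul hb)))
  calc _ = ∫⁻ s in Ioc 0 t, ∫⁻ z in Ioc (0 : ℝ) 1, ∫⁻ x : EuclideanSpace ℝ (Fin d),
        ENNReal.ofReal (s ^ ((d : ℝ) / α)) * H (s ^ (-((d : ℝ) / α)) * (g ‖x‖ * z)) ∂volume ∂lam := by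
        refine setLIntegral_congr_fun measurableSet_Ioc fun s hs => ?_
        rw [lintegral_pker_comp hG hinner hs.1, lintegral_lintegral_swap,
          ← lintegral_const_mul']
        · refine setLIntegral_congr_fun measurableSet_Ioc fun z _ => ?_
          rw [← lintegral_const_mul' _ _ ENNReal.ofReal_ne_top]
          simp only [mul_assoc]
        · exact ENNReal.ofReal_ne_top
        · exact (hH.comp (((hG.comp measurable_fst).const_mul _).mul
            measurable_snd)).aemeasurable
    _ = ∫⁻ z in Ioc (0 : ℝ) 1, ∫⁻ s in Ioc 0 t, ∫⁻ x : EuclideanSpace ℝ (Fin d),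
        ENNReal.ofReal (s ^ ((d : ℝ) / α)) *
          H (s ^ (-((d : ℝ) / α)) * (g ‖x‖ * z)) ∂volume ∂volume ∂lam := by
        refine lintegral_lintegral_swap (Measurable.aemeasurable ?_)
        exact Measurable.lintegral_prod_right' (f := fun q : (ℝ × ℝ) × EuclideanSpace ℝ (Fin d) =>
            ENNReal.ofReal (q.1.1 ^ ((d : ℝ) / α)) *
              H (q.1.1 ^ (-((d : ℝ) / α)) * (g ‖q.2‖ * q.1.2)))
          (hmeas (measurable_fst.comp measurable_fst)
            (measurable_snd.comp measurable_fst) measurable_snd)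
    _ = _ := by
        refine setLIntegral_congr_fun measurableSet_Ioc fun z _ => ?_
        exact lintegral_lintegral_swap
          (hmeas measurable_fst measurable_const measurable_snd).aemeasurable

lemma one_lt_rpow_neg_mul_iff {b w s : ℝ} (hb : 0 < b) (hw : 0 < w) (hs : 0 < s) :
    1 < s ^ (-b) * w ↔ s < w ^ b⁻¹ := by
  rw [Real.lt_rpow_inv_iff_of_pos hs.le hw.le hb, Real.rpow_neg hs.le, ← div_eq_inv_mul,
    one_lt_div (Real.rpow_pos_of_pos hs b)]

/-- Time integral of the large-jump part. -/
lemma lintegral_large_jump {b w t : ℝ} (hb : 0 < b) (hw : 0 < w) :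
    ∫⁻ s in Ioc 0 t, ENNReal.ofReal (s ^ b) *
        ENNReal.ofReal (if 1 < s ^ (-b) * w then s ^ (-b) * w else 0) =
      ENNReal.ofReal (w * min t (w ^ b⁻¹)) := by
  have hr : 0 < w ^ b⁻¹ := Real.rpow_pos_of_pos hw _
  have h1 : ∀ s ∈ Ioc 0 t, ENNReal.ofReal (s ^ b) *
        ENNReal.ofReal (if 1 < s ^ (-b) * w then s ^ (-b) * w else 0) =
      (Iio (w ^ b⁻¹)).indicator (fun _ => ENNReal.ofReal w) s := by
    intro s hs
    simp only [one_lt_rpow_neg_mul_iff hb hw hs.1, indicator, mem_Iio]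
    have : 0 < s ^ b := Real.rpow_pos_of_pos hs.1 b
    split_ifs
    · rw [← ENNReal.ofReal_mul this.le, Real.rpow_neg hs.1.le, mul_inv_cancel_left₀ this.ne']
    · simp
  rw [setLIntegral_congr_fun measurableSet_Ioc h1, lintegral_indicator measurableSet_Iio,
    setLIntegral_const, Measure.restrict_apply measurableSet_Iio,
    ENNReal.ofReal_mul hw.le]
  congr 1
  apply le_antisymm
  · exact (measure_mono (t := Ioc 0 (min t (w ^ b⁻¹))) fun s hs =>
      ⟨hs.2.1, le_min hs.2.2 (le_of_lt hs.1)⟩).trans_eq (by simp)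
  · refine Eq.trans_le (by simp) (measure_mono (s := Ioo 0 (min t (w ^ b⁻¹))) fun s hs => ?_)
    exact ⟨hs.2.trans_le (min_le_right _ _), hs.1, (hs.2.trans_le (min_le_left _ _)).le⟩

/-- Time integral of the small-jump part. -/
lemma lintegral_small_jump {b w t : ℝ} (hb : 0 < b) (hw : 0 < w) :
    ∫⁻ s in Ioc 0 t, ENNReal.ofReal (s ^ b) *
        ENNReal.ofReal (if s ^ (-b) * w ≤ 1 then (s ^ (-b) * w) ^ 2 else 0) =
      ENNReal.ofReal (w ^ 2) *
        ∫⁻ s in Ioc 0 t ∩ Ioi (w ^ b⁻¹), ENNReal.ofReal (s ^ (-b)) := by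
  have h1 : ∀ s ∈ Ioc 0 t, ENNReal.ofReal (s ^ b) *
        ENNReal.ofReal (if s ^ (-b) * w ≤ 1 then (s ^ (-b) * w) ^ 2 else 0) =
      (Ici (w ^ b⁻¹)).indicator
        (fun s => ENNReal.ofReal (w ^ 2) * ENNReal.ofReal (s ^ (-b))) s := by
    intro s hs
    simp only [← not_lt, one_lt_rpow_neg_mul_iff hb hw hs.1, indicator, mem_Ici]
    have : 0 < s ^ b := Real.rpow_pos_of_pos hs.1 b
    split_ifs
    · simp
    · rw [← ENNReal.ofReal_mul this.le, ← ENNReal.ofReal_mul (sq_nonneg w),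
        Real.rpow_neg hs.1.le]
      congr 1
      field_simp
  rw [setLIntegral_congr_fun measurableSet_Ioc h1, lintegral_indicator measurableSet_Ici,
    lintegral_const_mul' _ _ ENNReal.ofReal_ne_top,
    Measure.restrict_restrict measurableSet_Ici, inter_comm]
  congr 1
  exact setLIntegral_congr (ae_eq_set_inter ae_eq_rfl Ioi_ae_eq_Ici.symm)

lemma lintegral_rpow_neg_le_of_one_lt {b r t : ℝ} (hb : 1 < b) (hr : 0 < r) :
    ∫⁻ s in Ioc 0 t ∩ Ioi r, ENNReal.ofReal (s ^ (-b)) ≤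
      ENNReal.ofReal (r ^ (1 - b) / (b - 1)) := by
  refine (lintegral_mono_set inter_subset_right).trans_eq ?_
  rw [← ofReal_integral_eq_lintegral_ofReal (integrableOn_Ioi_rpow_of_lt (by linarith) hr),
    integral_Ioi_rpow_of_lt (by linarith) hr]
  · rw [neg_div, ← div_neg]
    ring_nf
  · filter_upwards [ae_restrict_mem measurableSet_Ioi] with s hs
    exact Real.rpow_nonneg (hr.trans hs).le _

lemma exists_lintegral_rpow_neg_le_of_lt_one {b : ℝ} (t : ℝ) (hb : b < 1) :
    ∃ K : ℝ, 0 ≤ K ∧ ∀ r : ℝ,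
      ∫⁻ s in Ioc 0 t ∩ Ioi r, ENNReal.ofReal (s ^ (-b)) ≤ ENNReal.ofReal K := by
  refine ⟨∫ s in Ioc 0 t, s ^ (-b),
    setIntegral_nonneg measurableSet_Ioc fun s hs => Real.rpow_nonneg hs.1.le _, fun r => ?_⟩
  refine (lintegral_mono_set inter_subset_left).trans_eq ?_
  rw [← ofReal_integral_eq_lintegral_ofReal]
  · exact (intervalIntegral.intervalIntegrable_rpow' (a := 0) (b := t) (by linarith)).1
  · filter_upwards [ae_restrict_mem measurableSet_Ioc] with s hs
    exact Real.rpow_nonneg hs.1.le _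

lemma lintegral_rpow_neg_one {r t : ℝ} (hr : 0 < r) (ht : 0 < t) :
    ∫⁻ s in Ioc 0 t ∩ Ioi r, ENNReal.ofReal (s ^ (-1 : ℝ)) =
      ENNReal.ofReal (Real.log (t / r)) := by
  have hset : Ioc 0 t ∩ Ioi r = Ioc r t := by
    ext s
    simp only [mem_inter_iff, mem_Ioc, mem_Ioi]
    constructor
    · tauto
    · exact fun h => ⟨⟨hr.trans h.1, h.2⟩, h.1⟩
  rw [hset]
  rcases le_or_gt r t with h | h
  · rw [← integral_inv_of_pos hr ht, intervalIntegral.integral_of_le h,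
      ofReal_integral_eq_lintegral_ofReal]
    · simp only [Real.rpow_neg_one]
    · refine (intervalIntegral.intervalIntegrable_inv (fun x hx => ?_) continuousOn_id).1
      rw [uIcc_of_le h] at hx
      exact (hr.trans_le hx.1).ne'
    · filter_upwards [ae_restrict_mem measurableSet_Ioc] with s hs
      exact inv_nonneg.2 (hr.trans hs.1).le
  · rw [Ioc_eq_empty (not_lt.2 h.le), ENNReal.ofReal_of_nonpos]
    · simp
    · exact Real.log_nonpos (by positivity) ((div_le_one hr).2 h.le)

lemma lintegral_lintegral_lt_top_of_le {E : Type*} [MeasurableSpace E] {μ : Measure E}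
    {lam : Measure ℝ} {G : E → ℝ} (hG0 : ∀ x, 0 ≤ G x) (hG1 : ∫⁻ x, ENNReal.ofReal (G x) ∂μ = 1)
    {S : ℝ → ℝ≥0∞} {Φ : ℝ → ℝ} {K : ℝ} (hK : 0 ≤ K)
    (h : ∀ z ∈ Ioc (0 : ℝ) 1, ∀ x, S (G x * z) ≤ ENNReal.ofReal (K * Φ z * G x))
    (hΦ : ∫⁻ z in Ioc (0 : ℝ) 1, ENNReal.ofReal (Φ z) ∂lam < ⊤) :
    ∫⁻ z in Ioc (0 : ℝ) 1, ∫⁻ x, S (G x * z) ∂μ ∂lam < ⊤ := by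
  calc _ ≤ ∫⁻ z in Ioc (0 : ℝ) 1, ENNReal.ofReal K * ENNReal.ofReal (Φ z) ∂lam := by
        refine setLIntegral_mono' measurableSet_Ioc fun z hz => ?_
        refine (lintegral_mono (h z hz)).trans_eq ?_
        simp only [ENNReal.ofReal_mul' (hG0 _), ENNReal.ofReal_mul hK]
        rw [lintegral_const_mul' _ _ (by finiteness), hG1, mul_one]
    _ < ⊤ := by
        rw [lintegral_const_mul' _ _ ENNReal.ofReal_ne_top]
        exact ENNReal.mul_lt_top ENNReal.ofReal_lt_top hΦ

lemma lintegral_lt_top_of_le_lintegral {E : Type*} [MeasurableSpace E] {μ : Measure E}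
    {lam : Measure ℝ} {G : E → ℝ} {B : Set E} (hB : μ B ≠ 0)
    {S : ℝ → ℝ≥0∞} {Ψ : ℝ → ℝ} {c : ℝ} (hc : 0 < c)
    (h : ∀ z ∈ Ioc (0 : ℝ) 1, ∀ x ∈ B, ENNReal.ofReal (c * Ψ z) ≤ S (G x * z))
    (hS : ∫⁻ z in Ioc (0 : ℝ) 1, ∫⁻ x, S (G x * z) ∂μ ∂lam < ⊤) (hBm : MeasurableSet B)
    (hB' : μ B ≠ ⊤) :
    ∫⁻ z in Ioc (0 : ℝ) 1, ENNReal.ofReal (Ψ z) ∂lam < ⊤ := by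
  have h1 : ENNReal.ofReal c * μ B * ∫⁻ z in Ioc (0 : ℝ) 1, ENNReal.ofReal (Ψ z) ∂lam ≤
      ∫⁻ z in Ioc (0 : ℝ) 1, ∫⁻ x, S (G x * z) ∂μ ∂lam := by
    rw [← lintegral_const_mul' _ _ (by finiteness)]
    refine setLIntegral_mono' measurableSet_Ioc fun z hz => ?_
    calc _ = ∫⁻ _ in B, ENNReal.ofReal (c * Ψ z) ∂μ := by
          rw [setLIntegral_const, ENNReal.ofReal_mul hc.le]; ring
      _ ≤ ∫⁻ x in B, S (G x * z) ∂μ := setLIntegral_mono' hBm (h z hz)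
      _ ≤ _ := setLIntegral_le_lintegral _ _
  exact (ENNReal.lt_top_of_mul_ne_top_right (h1.trans_lt hS).ne
    (mul_ne_zero (ENNReal.ofReal_pos.2 hc).ne' hB))

lemma rpow_one_add_mul_le {a M z β : ℝ} (ha : 0 < a) (haM : a ≤ M) (hz : 0 < z) (hβ : 0 ≤ β) :
    (a * z) ^ (1 + β) ≤ M ^ β * z ^ (1 + β) * a := by
  rw [Real.mul_rpow ha.le hz.le, Real.rpow_add ha, Real.rpow_one]
  have : a ^ β ≤ M ^ β := Real.rpow_le_rpow ha.le haM hβ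
  calc a * a ^ β * z ^ (1 + β) ≤ a * M ^ β * z ^ (1 + β) := by gcongr
    _ = _ := by ring

lemma mul_min_rpow_le {a M z t β : ℝ} (ha : 0 < a) (haM : a ≤ M) (hz : 0 < z) (hβ : 0 ≤ β) :
    a * z * min t ((a * z) ^ β) ≤ M ^ β * z ^ (1 + β) * a := by
  refine le_trans ?_ (rpow_one_add_mul_le ha haM hz hβ)
  rw [Real.rpow_add (by positivity), Real.rpow_one]
  gcongr
  exact min_le_right _ _

lemma le_mul_min_rpow {a m z t β : ℝ} (hm : 0 < m) (hma : m ≤ a) (ht : 0 < t)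
    (hz : z ∈ Ioc (0 : ℝ) 1) (hβ : 0 ≤ β) :
    m * min t (m ^ β) * z ^ (1 + β) ≤ a * z * min t ((a * z) ^ β) := by
  have hz0 := hz.1
  have ha : 0 < a := hm.trans_le hma
  have h1 : z ^ β ≤ 1 := Real.rpow_le_one hz0.le hz.2 hβ
  have h2 : 0 < z ^ β := Real.rpow_pos_of_pos hz0 _
  have h3 : min t (m ^ β) * z ^ β ≤ min t ((a * z) ^ β) := by
    refine le_min ?_ ?_
    · calc min t (m ^ β) * z ^ β ≤ t * 1 := by
            gcongr
            exact min_le_left _ _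
        _ = t := mul_one t
    · rw [Real.mul_rpow ha.le hz0.le]
      gcongr
      exact (min_le_right _ _).trans (Real.rpow_le_rpow hm.le hma hβ)
  rw [Real.rpow_add hz0, Real.rpow_one]
  calc m * min t (m ^ β) * (z * z ^ β) = m * z * (min t (m ^ β) * z ^ β) := by ring
    _ ≤ a * z * min t ((a * z) ^ β) := by gcongr

lemma abs_log_le_add_inv {a : ℝ} (ha : 0 < a) : |Real.log a| ≤ a + a⁻¹ := by
  have h1 := Real.log_le_sub_one_of_pos ha
  have h2 := Real.log_le_sub_one_of_pos (inv_pos.2 ha)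
  rw [Real.log_inv] at h2
  have := inv_pos.2 ha
  rw [abs_le]
  constructor <;> linarith

lemma sq_mul_log_div_le {a M z t : ℝ} (ha : 0 < a) (haM : a ≤ M) (hz : 0 < z) (ht : 0 < t) :
    (a * z) ^ 2 * Real.log (t / (a * z)) ≤
      (M * |Real.log t| + (M ^ 2 + 1) + M) * (z ^ 2 * |Real.log z| + z ^ 2) * a := by
  have hM : 0 < M := ha.trans_le haM
  rw [Real.log_div ht.ne' (by positivity), Real.log_mul ha.ne' hz.ne']
  have h1 : a * |Real.log a| ≤ M ^ 2 + 1 := by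
    calc a * |Real.log a| ≤ a * (a + a⁻¹) := by gcongr; exact abs_log_le_add_inv ha
      _ = a ^ 2 + 1 := by field_simp
      _ ≤ _ := by gcongr
  have h2 : Real.log t - (Real.log a + Real.log z) ≤
      |Real.log t| + |Real.log a| + |Real.log z| := by
    linarith [le_abs_self (Real.log t), neg_abs_le (Real.log a), neg_abs_le (Real.log z)]
  calc _ ≤ (a * z) ^ 2 * (|Real.log t| + |Real.log a| + |Real.log z|) := by gcongr
    _ = (a * |Real.log t| + a * |Real.log a| + a * |Real.log z|) * z ^ 2 * a := by ring
    _ ≤ (M * |Real.log t| + (M ^ 2 + 1) + M * |Real.log z|) * z ^ 2 * a := by gcongr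
    _ ≤ _ := by
      gcongr ?_ * a
      have : 0 ≤ (M * |Real.log t| + (M ^ 2 + 1)) * |Real.log z| * z ^ 2 := by positivity
      have : 0 ≤ M * z ^ 2 := by positivity
      linarith

lemma sq_mul_abs_log_le {M z t : ℝ} (hM : 0 < M) (hz : z ∈ Ioc (0 : ℝ) 1) (ht : 0 < t) :
    ENNReal.ofReal (z ^ 2 * |Real.log z|) ≤
      ENNReal.ofReal (z ^ 2 * Real.log (t / (M * z))) +
        ENNReal.ofReal |Real.log (t / M)| * ENNReal.ofReal (z ^ 2) := by
  rw [← ENNReal.ofReal_mul (abs_nonneg _)]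
  refine le_trans (ENNReal.ofReal_le_ofReal ?_) ENNReal.ofReal_add_le
  rw [← div_div, Real.log_div (by positivity) hz.1.ne',
    abs_of_nonpos (Real.log_nonpos hz.1.le hz.2)]
  nlinarith [neg_abs_le (Real.log (t / M)), sq_nonneg z]

theorem stmt19 (d : ℕ) (hd : 1 ≤ d) (α : ℝ) (hα : α ∈ Set.Ioo (0:ℝ) 2) (t : ℝ) (ht : 0 < t)
    (lam : MeasureTheory.Measure ℝ) [SigmaFinite lam]
    (hlam0 : lam (Set.Iic 0) = 0) (hlam_ne : lam ≠ 0)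
    (hmom : ∫⁻ z in Set.Ioi (0:ℝ), ENNReal.ofReal (min 1 (z ^ 2)) ∂lam ≠ ⊤)
    (g : ℝ → ℝ) (hg_cont : ContinuousOn g (Set.Ici 0))
    (hg_anti : StrictAntiOn g (Set.Ici 0)) (hg_pos : ∀ x : ℝ, 0 ≤ x → 0 < g x)
    (c₀ : ℝ) (hc₀ : 0 < c₀)
    (hg_tail : Filter.Tendsto (fun r : ℝ => r ^ ((d:ℝ) + α) * g r) Filter.atTop (nhds c₀))
    (hnorm : ∀ s : ℝ, 0 < s →
      ∫⁻ y : EuclideanSpace ℝ (Fin d), ENNReal.ofReal (pker d α g s y) = 1) :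
    ((∫⁻ s in Set.Ioc (0:ℝ) t, ∫⁻ y : EuclideanSpace ℝ (Fin d), ∫⁻ z in Set.Ioc (0:ℝ) 1,
        ENNReal.ofReal
          (if 1 < pker d α g s y * z then pker d α g s y * z else 0) ∂lam) < ⊤ ∧
      (∫⁻ s in Set.Ioc (0:ℝ) t, ∫⁻ y : EuclideanSpace ℝ (Fin d), ∫⁻ z in Set.Ioc (0:ℝ) 1,
        ENNReal.ofReal
          (if pker d α g s y * z ≤ 1 then (pker d α g s y * z) ^ 2 else 0) ∂lam) < ⊤) ↔
    ∫⁻ z in Set.Ioc (0:ℝ) 1,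
        ENNReal.ofReal (z ^ min (1 + α / (d:ℝ)) 2 *
          |Real.log z| ^ (if (d:ℝ) = α then (1:ℝ) else 0)) ∂lam < ⊤ := by
  have hd0 : (0 : ℝ) < d := by exact_mod_cast hd
  have hα0 := hα.1
  obtain ⟨b, hbdef⟩ : ∃ b : ℝ, b = (d : ℝ) / α := ⟨_, rfl⟩
  have hb : 0 < b := by rw [hbdef]; positivity
  have hβ : α / (d : ℝ) = b⁻¹ := by rw [hbdef, inv_div]
  have hdα : (d : ℝ) = α ↔ b = 1 := by rw [hbdef, div_eq_one_iff_eq hα0.ne']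
  have hGm : Measurable fun x : EuclideanSpace ℝ (Fin d) => g ‖x‖ :=
    (hg_cont.comp_continuous continuous_norm fun x => norm_nonneg x).measurable
  have hGpos : ∀ x : EuclideanSpace ℝ (Fin d), 0 < g ‖x‖ := fun x => hg_pos _ (norm_nonneg x)
  have hGM : ∀ x : EuclideanSpace ℝ (Fin d), g ‖x‖ ≤ g 0 := fun x =>
    hg_anti.antitoneOn self_mem_Ici (norm_nonneg x) (norm_nonneg x)
  have hGlow : ∀ x ∈ Metric.closedBall (0 : EuclideanSpace ℝ (Fin d)) 1, g 1 ≤ g ‖x‖ :=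
    fun x hx => hg_anti.antitoneOn (norm_nonneg x) (mem_Ici.2 zero_le_one)
      (mem_closedBall_zero_iff.1 hx)
  have hG1 : ∫⁻ x : EuclideanSpace ℝ (Fin d), ENNReal.ofReal (g ‖x‖) = 1 := by
    simpa [pker] using hnorm 1 one_pos
  have hM := hg_pos 0 le_rfl
  have hm := hg_pos 1 zero_le_one
  have hball : volume (Metric.closedBall (0 : EuclideanSpace ℝ (Fin d)) 1) ≠ 0 :=
    (Metric.measure_closedBall_pos _ _ one_pos).ne'
  have hball' : volume (Metric.closedBall (0 : EuclideanSpace ℝ (Fin d)) 1) ≠ ⊤ :=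
    measure_closedBall_lt_top.ne
  have hsq : ∫⁻ z in Ioc (0 : ℝ) 1, ENNReal.ofReal (z ^ 2) ∂lam < ⊤ := by
    refine lt_of_le_of_lt ?_ (lt_top_iff_ne_top.2 hmom)
    refine le_trans (setLIntegral_mono' measurableSet_Ioc fun z hz => ?_)
      (lintegral_mono_set Ioc_subset_Ioi_self)
    rw [min_eq_right (pow_le_one₀ hz.1.le hz.2)]
  have hmeasA : Measurable fun u : ℝ => ENNReal.ofReal (if 1 < u then u else 0) :=
    (Measurable.ite measurableSet_Ioi measurable_id measurable_const).ennreal_ofReal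
  have hmeasB : Measurable fun u : ℝ => ENNReal.ofReal (if u ≤ 1 then u ^ 2 else 0) :=
    (Measurable.ite measurableSet_Iic (measurable_id.pow_const 2)
      measurable_const).ennreal_ofReal
  rw [lintegral_pker_jump_swap lam hGm hmeasA t, lintegral_pker_jump_swap lam hGm hmeasB t]
  simp only [← hbdef, hβ, hdα]
  have hA : ∫⁻ z in Ioc (0 : ℝ) 1, ENNReal.ofReal (z ^ (1 + b⁻¹)) ∂lam < ⊤ ↔
      ∫⁻ z in Ioc (0 : ℝ) 1, ∫⁻ x : EuclideanSpace ℝ (Fin d), ∫⁻ s in Ioc 0 t,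
        ENNReal.ofReal (s ^ b) * ENNReal.ofReal (if 1 < s ^ (-b) * (g ‖x‖ * z)
          then s ^ (-b) * (g ‖x‖ * z) else 0) ∂volume ∂volume ∂lam < ⊤ := by
    constructor
    · refine lintegral_lintegral_lt_top_of_le (S := fun w => ∫⁻ s in Ioc 0 t,
        ENNReal.ofReal (s ^ b) * ENNReal.ofReal (if 1 < s ^ (-b) * w then s ^ (-b) * w else 0))
        (fun x => (hGpos x).le) hG1 (Real.rpow_nonneg hM.le b⁻¹) fun z hz x => ?_
      rw [lintegral_large_jump hb (mul_pos (hGpos x) hz.1)]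
      exact ENNReal.ofReal_le_ofReal
        (mul_min_rpow_le (hGpos x) (hGM x) hz.1 (inv_nonneg.2 hb.le))
    · intro h
      refine lintegral_lt_top_of_le_lintegral hball (S := fun w => ∫⁻ s in Ioc 0 t,
        ENNReal.ofReal (s ^ b) * ENNReal.ofReal (if 1 < s ^ (-b) * w then s ^ (-b) * w else 0))
        (mul_pos hm (lt_min ht (Real.rpow_pos_of_pos hm b⁻¹))) (fun z hz x hx => ?_) h
        Metric.isClosed_closedBall.measurableSet hball'
      rw [lintegral_large_jump hb (mul_pos (hGpos x) hz.1)]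
      exact ENNReal.ofReal_le_ofReal
        (le_mul_min_rpow hm (hGlow x hx) ht hz (inv_nonneg.2 hb.le))
  have hB : ∀ {Φ : ℝ → ℝ} {K : ℝ}, 0 ≤ K →
      (∀ z ∈ Ioc (0 : ℝ) 1, ∀ a, 0 < a → a ≤ g 0 → ENNReal.ofReal ((a * z) ^ 2) *
        ∫⁻ s in Ioc 0 t ∩ Ioi ((a * z) ^ b⁻¹), ENNReal.ofReal (s ^ (-b)) ≤
          ENNReal.ofReal (K * Φ z * a)) →
      ∫⁻ z in Ioc (0 : ℝ) 1, ENNReal.ofReal (Φ z) ∂lam < ⊤ →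
      ∫⁻ z in Ioc (0 : ℝ) 1, ∫⁻ x : EuclideanSpace ℝ (Fin d), ∫⁻ s in Ioc 0 t,
        ENNReal.ofReal (s ^ b) * ENNReal.ofReal (if s ^ (-b) * (g ‖x‖ * z) ≤ 1
          then (s ^ (-b) * (g ‖x‖ * z)) ^ 2 else 0) ∂volume ∂volume ∂lam < ⊤ := by
    intro Φ K hK h
    refine lintegral_lintegral_lt_top_of_le (S := fun w => ∫⁻ s in Ioc 0 t,
      ENNReal.ofReal (s ^ b) * ENNReal.ofReal (if s ^ (-b) * w ≤ 1 then (s ^ (-b) * w) ^ 2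
        else 0)) (fun x => (hGpos x).le) hG1 hK fun z hz x => ?_
    rw [lintegral_small_jump hb (mul_pos (hGpos x) hz.1)]
    exact h z hz _ (hGpos x) (hGM x)
  have hAsq (hb1 : b ≤ 1) :
      ∫⁻ z in Ioc (0 : ℝ) 1, ENNReal.ofReal (z ^ (1 + b⁻¹)) ∂lam < ⊤ := by
    refine lt_of_le_of_lt (setLIntegral_mono' measurableSet_Ioc fun z hz => ?_) hsq
    refine ENNReal.ofReal_le_ofReal ?_
    rw [← Real.rpow_natCast]
    refine Real.rpow_le_rpow_of_exponent_ge hz.1 hz.2 ?_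
    have := (one_le_inv₀ hb).2 hb1
    push_cast
    linarith
  rcases lt_trichotomy b 1 with hb1 | hb1 | hb1
  · have hmin : min (1 + b⁻¹) 2 = (2 : ℝ) :=
      min_eq_right (by linarith [(one_le_inv₀ hb).2 hb1.le])
    simp only [hmin, hb1.ne, if_false, Real.rpow_zero, mul_one, Real.rpow_two]
    refine ⟨fun _ => hsq, fun _ => ⟨hA.1 (hAsq hb1.le), ?_⟩⟩
    obtain ⟨K, hK, hKb⟩ := exists_lintegral_rpow_neg_le_of_lt_one t hb1
    refine hB (mul_nonneg hK hM.le) (fun z hz a ha haM => ?_) hsq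
    refine (mul_le_mul_right (hKb _) _).trans ?_
    rw [← ENNReal.ofReal_mul (sq_nonneg _)]
    refine ENNReal.ofReal_le_ofReal ?_
    calc (a * z) ^ 2 * K = K * a * z ^ 2 * a := by ring
      _ ≤ K * g 0 * z ^ 2 * a := by gcongr
  · subst hb1
    have hmin : min (1 + (1 : ℝ)⁻¹) 2 = (2 : ℝ) := by norm_num
    simp only [hmin, if_true, Real.rpow_one, Real.rpow_two]
    constructor
    · rintro ⟨-, h⟩
      have hlog : ∫⁻ z in Ioc (0 : ℝ) 1,
          ENNReal.ofReal (z ^ 2 * Real.log (t / (g 0 * z))) ∂lam < ⊤ := by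
        refine lintegral_lt_top_of_le_lintegral hball (S := fun w => ∫⁻ s in Ioc 0 t,
          ENNReal.ofReal (s ^ (1 : ℝ)) * ENNReal.ofReal (if s ^ (-1 : ℝ) * w ≤ 1
            then (s ^ (-1 : ℝ) * w) ^ 2 else 0)) (pow_pos hm 2) (fun z hz x hx => ?_)
          (by simpa only [Real.rpow_one] using h)
          Metric.isClosed_closedBall.measurableSet hball'
        have hz0 := hz.1
        have hx0 := hGpos x
        rw [lintegral_small_jump one_pos (mul_pos hx0 hz0), inv_one, Real.rpow_one,
          lintegral_rpow_neg_one (mul_pos hx0 hz0) ht, ← mul_assoc, ← mul_pow,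
          ENNReal.ofReal_mul (by positivity)]
        have h1 := hGlow x hx
        have h2 := hGM x
        gcongr
      refine lt_of_le_of_lt (setLIntegral_mono' measurableSet_Ioc fun z hz =>
        sq_mul_abs_log_le hM hz ht) ?_
      rw [lintegral_add_right _ (by fun_prop), lintegral_const_mul' _ _ ENNReal.ofReal_ne_top]
      exact ENNReal.add_lt_top.2 ⟨hlog, ENNReal.mul_lt_top ENNReal.ofReal_lt_top hsq⟩
    · intro h
      refine ⟨by simpa only [Real.rpow_one] using hA.1 (hAsq le_rfl), ?_⟩
      have hsum : ∫⁻ z in Ioc (0 : ℝ) 1,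
          ENNReal.ofReal (z ^ 2 * |Real.log z| + z ^ 2) ∂lam < ⊤ := by
        refine lt_of_le_of_lt (lintegral_mono fun z => ENNReal.ofReal_add_le) ?_
        rw [lintegral_add_right _ (by fun_prop)]
        exact ENNReal.add_lt_top.2 ⟨h, hsq⟩
      have hK : 0 ≤ g 0 * |Real.log t| + (g 0 ^ 2 + 1) + g 0 := by positivity
      simpa only [Real.rpow_one] using hB hK (fun z hz a ha haM => by
        rw [inv_one, Real.rpow_one, lintegral_rpow_neg_one (mul_pos ha hz.1) ht,
          ← ENNReal.ofReal_mul (sq_nonneg _)]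
        exact ENNReal.ofReal_le_ofReal (sq_mul_log_div_le ha haM hz.1 ht)) hsum
  · have hmin : min (1 + b⁻¹) 2 = 1 + b⁻¹ :=
      min_eq_left (by linarith [inv_le_one_of_one_le₀ hb1.le])
    simp only [hmin, hb1.ne', if_false, Real.rpow_zero, mul_one]
    refine ⟨fun h => hA.2 h.1, fun h => ⟨hA.1 h, ?_⟩⟩
    have hb1' : 0 < b - 1 := sub_pos.2 hb1
    refine hB (div_nonneg (Real.rpow_nonneg hM.le b⁻¹) hb1'.le) (fun z hz a ha haM => ?_) h
    have hw : 0 < a * z := mul_pos ha hz.1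
    refine (mul_le_mul_right (lintegral_rpow_neg_le_of_one_lt hb1
      (Real.rpow_pos_of_pos hw _)) _).trans ?_
    rw [← ENNReal.ofReal_mul (sq_nonneg _)]
    refine ENNReal.ofReal_le_ofReal ?_
    have hexp : (a * z) ^ 2 * ((a * z) ^ b⁻¹) ^ (1 - b) = (a * z) ^ (1 + b⁻¹) := by
      rw [← Real.rpow_mul hw.le, ← Real.rpow_natCast, ← Real.rpow_add hw]
      congr 1
      push_cast
      field_simp
      ring
    calc _ = (a * z) ^ (1 + b⁻¹) / (b - 1) := by rw [mul_div_assoc', hexp]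
      _ ≤ g 0 ^ b⁻¹ * z ^ (1 + b⁻¹) * a / (b - 1) := by
        gcongr
        exact rpow_one_add_mul_le ha haM hz.1 (inv_nonneg.2 hb.le)
      _ = _ := by ring
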